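/- Let N ≥ 3, let Ω and B be open subsets of ℝ^N, and let χ : ℝ^N → [0,1] be a smooth function with compact support that equals 1 on the closure of B. Then: (a) for every smooth function ψ with compact support contained in Ω ∪ B, the function (1−χ)ψ is smooth with compact support contained in Ω; and (b) there exists a constant C > 0, depending only on N and χ, such that ∫ |∇((1−χ)ψ)|² ≤ C ∫ |∇ψ|² for all smooth ψ with compact support contained in Ω ∪ B. -/

import Mathlib

open MeasureTheory Filter Topology

/-- The Dirichlet energy `∫ |∇u|²` of a function on `ℝᴺ`. -/
noncomputable def grad2 (N : ℕ) (u : EuclideanSpace ℝ (Fin N) → ℝ) : ℝ :=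
  ∫ x, ‖fderiv ℝ u x‖ ^ 2

/-- The weighted mass `∫ V u²`. -/
noncomputable def ven (N : ℕ) (V u : EuclideanSpace ℝ (Fin N) → ℝ) : ℝ :=
  ∫ x, V x * u x ^ 2

/-- A smooth test function with compact support contained in `Ω`. -/
def IsTest (N : ℕ) (Ω : Set (EuclideanSpace ℝ (Fin N)))
    (u : EuclideanSpace ℝ (Fin N) → ℝ) : Prop :=
  ContDiff ℝ (⊤ : ℕ∞) u ∧ HasCompactSupport u ∧ tsupport u ⊆ Ω

/-- The Rayleigh quotient infimum `μ_Ω`. -/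
noncomputable def mu (N : ℕ) (V : EuclideanSpace ℝ (Fin N) → ℝ)
    (Ω : Set (EuclideanSpace ℝ (Fin N))) : ℝ :=
  sInf {q : ℝ | ∃ u, IsTest N Ω u ∧ 0 < ven N V u ∧ q = grad2 N u / ven N V u}

/-- A normalized minimizing sequence for `μ_Ω`. -/
def MinimizingSeq (N : ℕ) (V : EuclideanSpace ℝ (Fin N) → ℝ)
    (Ω : Set (EuclideanSpace ℝ (Fin N)))
    (u : ℕ → EuclideanSpace ℝ (Fin N) → ℝ) : Prop :=
  (∀ k, IsTest N Ω (u k)) ∧ (∀ k, ven N V (u k) = 1) ∧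
    Tendsto (fun k => grad2 N (u k)) atTop (𝓝 (mu N V Ω))

/-- The gradients `∇u_k` form a Cauchy sequence in `L²(ℝᴺ; ℝᴺ)`. -/
def GradCauchy (N : ℕ) (u : ℕ → EuclideanSpace ℝ (Fin N) → ℝ) : Prop :=
  ∀ ε : ℝ, 0 < ε → ∃ M : ℕ, ∀ j ≥ M, ∀ l ≥ M,
    (∫ x, ‖fderiv ℝ (u j) x - fderiv ℝ (u l) x‖ ^ 2) < ε

/-- `V` is locally `L^p` on `X`. -/
def LocLp (N : ℕ) (p : ℝ) (V : EuclideanSpace ℝ (Fin N) → ℝ)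
    (X : Set (EuclideanSpace ℝ (Fin N))) : Prop :=
  ∀ K : Set (EuclideanSpace ℝ (Fin N)), IsCompact K → K ⊆ X →
    IntegrableOn (fun x => V x ^ p) K
open scoped NNReal ENNReal in
/-- The exponents `2N/(N-2)` and `N` are Hölder conjugate relative to `2`. -/
lemma exists_sobolev_exponent {N : ℕ} (hN : 3 ≤ N) :
    ∃ p : ℝ≥0, (p : ℝ)⁻¹ = ((2 : ℝ≥0) : ℝ)⁻¹ - (N : ℝ)⁻¹ ∧
      ENNReal.HolderTriple (p : ℝ≥0∞) ((N : ℝ≥0) : ℝ≥0∞) ((2 : ℝ≥0) : ℝ≥0∞) := by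
  have hN' : (3 : ℝ) ≤ N := by exact_mod_cast hN
  have hlt : (N : ℝ)⁻¹ < 2⁻¹ := by
    apply inv_strictAnti₀ <;> linarith
  have hpos : (0 : ℝ) < 2⁻¹ - (N : ℝ)⁻¹ := by linarith
  obtain ⟨q, hq⟩ : ∃ q : ℝ≥0, (q : ℝ) = 2⁻¹ - (N : ℝ)⁻¹ := CanLift.prf _ hpos.le
  have hq0 : q ≠ 0 := fun h => hpos.ne' (by rw [← hq, h, NNReal.coe_zero])
  have hN0 : (N : ℝ≥0) ≠ 0 := Nat.cast_ne_zero.2 (by omega)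
  refine ⟨q⁻¹, by simp [hq], ⟨?_⟩⟩
  rw [← ENNReal.coe_inv (inv_ne_zero hq0), inv_inv, ← ENNReal.coe_inv hN0,
    ← ENNReal.coe_inv two_ne_zero, ← ENNReal.coe_add, ENNReal.coe_inj, ← NNReal.coe_inj]
  simp [hq]

open scoped NNReal ENNReal in
/-- For compactly supported `C¹` functions the Dirichlet energy is the squared `L²` seminorm of
the derivative. -/
lemma grad2_eq_toReal_eLpNorm_sq {N : ℕ} {u : EuclideanSpace ℝ (Fin N) → ℝ}
    (hu : ContDiff ℝ 1 u) (hcs : HasCompactSupport u) :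
    grad2 N u = (eLpNorm (fderiv ℝ u) ((2 : ℝ≥0) : ℝ≥0∞) volume).toReal ^ 2 := by
  have hmem : MemLp (fderiv ℝ u) ((2 : ℝ≥0) : ℝ≥0∞) volume :=
    (hu.continuous_fderiv one_ne_zero).memLp_of_hasCompactSupport (hcs.fderiv (𝕜 := ℝ))
  have hnn : 0 ≤ ∫ x, ‖fderiv ℝ u x‖ ^ 2 := integral_nonneg fun x => sq_nonneg _
  rw [hmem.eLpNorm_eq_integral_rpow_norm (by simp) (by simp)]
  simp only [ENNReal.coe_toReal, NNReal.coe_ofNat, Real.rpow_ofNat]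
  rw [ENNReal.toReal_ofReal (Real.rpow_nonneg hnn _), ← Real.rpow_natCast, ← Real.rpow_mul hnn]
  simp [grad2]

/-- If `χ = 1` on `closure B`, multiplication by `1 - χ` maps test functions on `Ω ∪ B` to test
functions on `Ω`. -/
lemma IsTest.one_sub_mul {N : ℕ} {χ ψ : EuclideanSpace ℝ (Fin N) → ℝ}
    {Ω B : Set (EuclideanSpace ℝ (Fin N))} (hχ : ContDiff ℝ (⊤ : ℕ∞) χ) (hB : IsOpen B)
    (h1 : ∀ x ∈ closure B, χ x = 1) (hψ : IsTest N (Ω ∪ B) ψ) :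
    IsTest N Ω (fun x => (1 - χ x) * ψ x) := by
  obtain ⟨hsm, hcs, hsub⟩ := hψ
  refine ⟨(contDiff_const.sub hχ).mul hsm, hcs.mul_left, fun x hx => ?_⟩
  refine (hsub (tsupport_mul_subset_right (f := fun x => 1 - χ x) hx)).resolve_right fun hxB => ?_
  refine notMem_tsupport_iff_eventuallyEq.2 ?_ hx
  filter_upwards [hB.mem_nhds hxB] with y hy
  simp [h1 y (subset_closure hy)]

open scoped NNReal ENNReal in
/-- Multiplication by `1 - χ` is bounded for the homogeneous Sobolev seminorm: the term `ψ ∇χ` is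
controlled by the Hölder and Gagliardo–Nirenberg–Sobolev inequalities. -/
lemma exists_eLpNorm_fderiv_one_sub_mul_le {N : ℕ} (hN : 3 ≤ N)
    {χ : EuclideanSpace ℝ (Fin N) → ℝ} (hχ : ContDiff ℝ 1 χ) (hχcs : HasCompactSupport χ)
    (hχ01 : ∀ x, χ x ∈ Set.Icc (0 : ℝ) 1) :
    ∃ K : ℝ≥0, ∀ ψ : EuclideanSpace ℝ (Fin N) → ℝ, ContDiff ℝ 1 ψ → HasCompactSupport ψ →
      eLpNorm (fderiv ℝ fun x => (1 - χ x) * ψ x) ((2 : ℝ≥0) : ℝ≥0∞) volume ≤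
        (1 + K) * eLpNorm (fderiv ℝ ψ) ((2 : ℝ≥0) : ℝ≥0∞) volume := by
  obtain ⟨p, hp, hpt⟩ := exists_sobolev_exponent hN
  have hcχ := hχ.continuous_fderiv one_ne_zero
  have hmem : MemLp (fderiv ℝ χ) ((N : ℝ≥0) : ℝ≥0∞) volume :=
    hcχ.memLp_of_hasCompactSupport (hχcs.fderiv (𝕜 := ℝ))
  let S : ℝ≥0 := SNormLESNormFDerivOfEqConst ℝ
    (volume : Measure (EuclideanSpace ℝ (Fin N))) ((2 : ℝ≥0) : ℝ)
  refine ⟨S * (eLpNorm (fderiv ℝ χ) ((N : ℝ≥0) : ℝ≥0∞) volume).toNNReal, fun ψ hψ hψcs => ?_⟩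
  have hcψ := hψ.continuous_fderiv one_ne_zero
  have hfd : (fderiv ℝ fun x => (1 - χ x) * ψ x) =
      (fun x => (1 - χ x) • fderiv ℝ ψ x) - (ψ • fderiv ℝ χ) := by
    ext1 x
    have hdχ := (hχ.differentiable one_ne_zero) x
    rw [fderiv_fun_mul (hdχ.const_sub 1) ((hψ.differentiable one_ne_zero) x), fderiv_const_sub]
    simp [sub_eq_add_neg]
  have hfirst : eLpNorm (fun x => (1 - χ x) • fderiv ℝ ψ x) ((2 : ℝ≥0) : ℝ≥0∞) volume ≤
      eLpNorm (fderiv ℝ ψ) ((2 : ℝ≥0) : ℝ≥0∞) volume := by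
    refine eLpNorm_mono fun x => ?_
    have habs : |1 - χ x| ≤ 1 := by
      rw [abs_le]
      constructor <;> linarith [(hχ01 x).1, (hχ01 x).2]
    rw [norm_smul, Real.norm_eq_abs]
    exact mul_le_of_le_one_left (norm_nonneg _) habs
  have hsobolev : eLpNorm ψ p volume ≤
      S * eLpNorm (fderiv ℝ ψ) ((2 : ℝ≥0) : ℝ≥0∞) volume :=
    eLpNorm_le_eLpNorm_fderiv_of_eq volume hψ hψcs one_le_two
      (by rw [finrank_euclideanSpace_fin]; omega) (by simp [hp])
  have hsecond : eLpNorm (ψ • fderiv ℝ χ) ((2 : ℝ≥0) : ℝ≥0∞) volume ≤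
      eLpNorm ψ p volume * eLpNorm (fderiv ℝ χ) ((N : ℝ≥0) : ℝ≥0∞) volume :=
    eLpNorm_smul_le_mul_eLpNorm hcχ.aestronglyMeasurable hψ.continuous.aestronglyMeasurable
  rw [hfd, ENNReal.coe_mul, ENNReal.coe_toNNReal hmem.eLpNorm_ne_top]
  calc _ ≤ _ := eLpNorm_sub_le
        ((continuous_const.sub hχ.continuous).smul hcψ).aestronglyMeasurable
        (hψ.continuous.smul hcχ).aestronglyMeasurable (by exact_mod_cast one_le_two)
    _ ≤ _ := add_le_add hfirst (hsecond.trans (mul_le_mul_left hsobolev _))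
    _ = _ := by ring

/-- **The Claim in the proof of Lemma 2.2 of Pinchover–Tintarev.** (a) If `ψ` is a smooth
function compactly supported in `Ω ∪ B`, then `(1−χ)ψ` is a smooth function compactly
supported in `Ω`; (b) with a constant `C > 0` depending only on `N` and `χ`,
`∫|∇((1−χ)ψ)|² ≤ C ∫|∇ψ|²`. -/
theorem cutoff_maps_test_functions_into_omega
    (N : ℕ) (hN : 3 ≤ N)
    (χ : EuclideanSpace ℝ (Fin N) → ℝ) (hχsm : ContDiff ℝ (⊤ : ℕ∞) χ)
    (hχcs : HasCompactSupport χ) (hχ01 : ∀ x, χ x ∈ Set.Icc (0 : ℝ) 1) :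
    (∀ Ω B : Set (EuclideanSpace ℝ (Fin N)), IsOpen Ω → IsOpen B →
      (∀ x ∈ closure B, χ x = 1) →
      ∀ ψ : EuclideanSpace ℝ (Fin N) → ℝ, IsTest N (Ω ∪ B) ψ →
        IsTest N Ω (fun x => (1 - χ x) * ψ x)) ∧
    ∃ C : ℝ, 0 < C ∧ ∀ Ω B : Set (EuclideanSpace ℝ (Fin N)), IsOpen Ω → IsOpen B →
      (∀ x ∈ closure B, χ x = 1) →
      ∀ ψ : EuclideanSpace ℝ (Fin N) → ℝ, IsTest N (Ω ∪ B) ψ →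
        grad2 N (fun x => (1 - χ x) * ψ x) ≤ C * grad2 N ψ := by
  refine ⟨fun Ω B _ hB h1 ψ hψ => hψ.one_sub_mul hχsm hB h1, ?_⟩
  have hle : ((1 : ℕ∞) : WithTop ℕ∞) ≤ ((⊤ : ℕ∞) : WithTop ℕ∞) := by exact_mod_cast le_top
  obtain ⟨K, hK⟩ := exists_eLpNorm_fderiv_one_sub_mul_le hN (hχsm.of_le hle) hχcs hχ01
  refine ⟨(1 + K) ^ 2, by positivity, fun Ω B _ hB h1 ψ hψ => ?_⟩
  have hφ := hψ.one_sub_mul hχsm hB h1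
  have hψ1 := hψ.1.of_le hle
  have hfin : eLpNorm (fderiv ℝ ψ) ((2 : NNReal) : ENNReal) volume ≠ ⊤ :=
    ((hψ1.continuous_fderiv one_ne_zero).memLp_of_hasCompactSupport
      (hψ.2.1.fderiv (𝕜 := ℝ))).eLpNorm_ne_top
  rw [grad2_eq_toReal_eLpNorm_sq (hφ.1.of_le hle) hφ.2.1,
    grad2_eq_toReal_eLpNorm_sq hψ1 hψ.2.1, ← mul_pow]
  refine pow_le_pow_left₀ ENNReal.toReal_nonneg ?_ 2
  have h := ENNReal.toReal_mono (ENNReal.mul_ne_top (by simp) hfin) (hK ψ hψ1 hψ.2.1)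
  rwa [ENNReal.toReal_mul, ENNReal.toReal_add (by simp) (by simp), ENNReal.toReal_one,
    ENNReal.coe_toReal] at h
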